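/- Let Θ be a real symmetric positive definite 3×3 matrix, let T = (trace Θ)/3, and let ν ∈ [-1/2, 1). Then the matrix (1−ν)T·I + νΘ is positive definite, where I is the 3×3 identity matrix. -/

import Mathlib

open scoped Matrix in
/-- For `x : ℝ³`, the value of the quadratic form of `trace Θ • 1 - Θ` at `x` is the sum of the
values of the form of `Θ` at the cross products of `x` with the standard basis vectors. -/
theorem Matrix.dotProduct_trace_smul_one_sub_mulVec (Θ : Matrix (Fin 3) (Fin 3) ℝ)
    (x : Fin 3 → ℝ) :
    x ⬝ᵥ ((Θ.trace • (1 : Matrix (Fin 3) (Fin 3) ℝ) - Θ) *ᵥ x) =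
      ![0, -x 2, x 1] ⬝ᵥ (Θ *ᵥ ![0, -x 2, x 1]) + ![x 2, 0, -x 0] ⬝ᵥ (Θ *ᵥ ![x 2, 0, -x 0]) +
        ![-x 1, x 0, 0] ⬝ᵥ (Θ *ᵥ ![-x 1, x 0, 0]) := by
  simp [Matrix.mulVec, dotProduct, Fin.sum_univ_three,
    Matrix.trace]
  ring

/-- In dimension three, `trace Θ • 1 - Θ` is positive definite when `Θ` is. -/
theorem Matrix.PosDef.trace_smul_one_sub {Θ : Matrix (Fin 3) (Fin 3) ℝ} (hΘ : Θ.PosDef) :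
    (Θ.trace • (1 : Matrix (Fin 3) (Fin 3) ℝ) - Θ).PosDef := by
  refine .of_dotProduct_mulVec_pos ?_ fun {x} hx => ?_
  · exact (Matrix.isHermitian_one.smul (IsSelfAdjoint.all _)).sub hΘ.isHermitian
  rw [star_trivial, Matrix.dotProduct_trace_smul_one_sub_mulVec]
  have hnonneg (y : Fin 3 → ℝ) : 0 ≤ y ⬝ᵥ Θ.mulVec y := by
    simpa using hΘ.posSemidef.dotProduct_mulVec_nonneg y
  have hpos (y : Fin 3 → ℝ) (hy : y ≠ 0) : 0 < y ⬝ᵥ Θ.mulVec y := by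
    simpa using hΘ.dotProduct_mulVec_pos hy
  have h₀ := hnonneg ![0, -x 2, x 1]
  have h₁ := hnonneg ![x 2, 0, -x 0]
  have h₂ := hnonneg ![-x 1, x 0, 0]
  by_cases hx₀ : x 0 = 0
  · have hy : ![0, -x 2, x 1] ≠ 0 := by
      intro h
      have hx₁ : x 1 = 0 := by simpa using congrFun h 2
      have hx₂ : x 2 = 0 := by simpa using congrFun h 1
      exact hx (by ext i; fin_cases i <;> assumption)
    linarith [hpos _ hy]
  · have hy : ![x 2, 0, -x 0] ≠ 0 := fun h => hx₀ (by simpa using congrFun h 2)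
    linarith [hpos _ hy]

theorem stmt_9 (Θ : Matrix (Fin 3) (Fin 3) ℝ) (hΘ : Θ.PosDef) (ν : ℝ)
    (hν1 : -1/2 ≤ ν) (hν2 : ν < 1) :
    (((1-ν) * (Θ.trace / 3)) • (1 : Matrix (Fin 3) (Fin 3) ℝ) + ν • Θ).PosDef := by
  have htr : 0 < Θ.trace := hΘ.trace_pos
  rcases le_or_gt 0 ν with hν | hν
  · have hc : 0 < (1 - ν) * (Θ.trace / 3) := mul_pos (by linarith) (by linarith)
    exact (Matrix.PosDef.one.smul hc).add_posSemidef (hΘ.posSemidef.smul hν)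
  · have hc : 0 ≤ (1 + 2 * ν) * (Θ.trace / 3) := mul_nonneg (by linarith) (by linarith)
    have hdecomp : ((1 - ν) * (Θ.trace / 3)) • (1 : Matrix (Fin 3) (Fin 3) ℝ) + ν • Θ =
        (-ν) • (Θ.trace • (1 : Matrix (Fin 3) (Fin 3) ℝ) - Θ) +
          ((1 + 2 * ν) * (Θ.trace / 3)) • (1 : Matrix (Fin 3) (Fin 3) ℝ) := by
      module
    rw [hdecomp]
    exact (hΘ.trace_smul_one_sub.smul (neg_pos.mpr hν)).add_posSemidef
      (Matrix.PosSemidef.one.smul hc)
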